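/- arXiv:2504.04356 — 3 statements merged into one kernel-verified Lean document; each statement's English description precedes it below -/
import Mathlib

section
/- Let t > 0 be a real number and let μ_1 ≤ μ_2 ≤ ⋯ be a nondecreasing sequence of positive real numbers satisfying the Yang-type inequality with parameter t. Then for every integer k ≥ 1, F_k ≤ (2/t) k^{4/t} μ_1^2. -/
/-- The third-order Taylor polynomial of `(1 - z) ^ (-a)` is a lower bound on `[0, 1)`. -/
theorem taylor_mul_one_sub_rpow_le_one {a z : ℝ} (ha : 0 < a) (hz0 : 0 ≤ z) (hz1 : z < 1) :
    (1 - z) ^ a * (1 + a * z + a * (a + 1) / 2 * z ^ 2 + a * (a + 1) * (a + 2) / 6 * z ^ 3) ≤ 1 := by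
  set f : ℝ → ℝ := fun w ↦
    (1 - w) ^ a * (1 + a * w + a * (a + 1) / 2 * w ^ 2 + a * (a + 1) * (a + 2) / 6 * w ^ 3)
    with hf
  have hderiv : ∀ w < 1, HasDerivAt f
      (-((1 - w) ^ (a - 1) * (a * (a + 1) * (a + 2) * (a + 3) / 6 * w ^ 3))) w := by
    intro w hw
    have hw' : 0 < 1 - w := sub_pos.2 hw
    have h₁ : HasDerivAt (fun w : ℝ ↦ (1 - w) ^ a) (-1 * a * (1 - w) ^ (a - 1)) w :=
      ((hasDerivAt_id w).const_sub 1).rpow_const (Or.inl hw'.ne')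
    have h₂ : HasDerivAt
        (fun w : ℝ ↦ 1 + a * w + a * (a + 1) / 2 * w ^ 2 + a * (a + 1) * (a + 2) / 6 * w ^ 3)
        (a * 1 + a * (a + 1) / 2 * (2 * w) + a * (a + 1) * (a + 2) / 6 * (3 * w ^ 2)) w := by
      have e₁ := ((hasDerivAt_id w).const_mul a).const_add 1
      have e₂ := (hasDerivAt_pow 2 w).const_mul (a * (a + 1) / 2)
      have e₃ := (hasDerivAt_pow 3 w).const_mul (a * (a + 1) * (a + 2) / 6)
      exact ((e₁.add e₂).add e₃).congr_deriv (by norm_num)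
    refine (h₁.mul h₂).congr_deriv ?_
    have hsplit : (1 - w) ^ a = (1 - w) ^ (a - 1) * (1 - w) := by
      rw [← Real.rpow_add_one hw'.ne', sub_add_cancel]
    rw [hsplit]
    ring
  have hanti : AntitoneOn f (Set.Icc 0 z) := by
    refine antitoneOn_of_deriv_nonpos (convex_Icc 0 z)
      (fun w hw ↦ (hderiv w (hw.2.trans_lt hz1)).continuousAt.continuousWithinAt) ?_ ?_ <;>
      rw [interior_Icc]
    · exact fun w hw ↦ (hderiv w (hw.2.trans hz1)).differentiableAt.differentiableWithinAt
    · intro w hw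
      rw [(hderiv w (hw.2.trans hz1)).deriv, neg_nonpos]
      have := hw.1
      have : 0 < 1 - w := sub_pos.2 (hw.2.trans hz1)
      positivity
  have := hanti (Set.left_mem_Icc.2 hz0) (Set.right_mem_Icc.2 hz0) hz0
  simpa [hf] using this

theorem taylor_le_div_rpow {p n : ℝ} (hp : 0 < p) (hn : 1 ≤ n) :
    1 + 2 * p / (n + 1) + p * (2 * p + 1) / (n + 1) ^ 2
      + 2 * p * (2 * p + 1) * (p + 1) / (3 * (n + 1) ^ 3) ≤ ((n + 1) / n) ^ (2 * p) := by
  have hn0 : 0 < n := by linarith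
  have hz : 1 / (n + 1) < 1 := by rw [div_lt_one (by linarith)]; linarith
  have h := taylor_mul_one_sub_rpow_le_one (a := 2 * p) (by linarith)
    (by positivity : (0 : ℝ) ≤ 1 / (n + 1)) hz
  have hinv : 1 - 1 / (n + 1) = ((n + 1) / n)⁻¹ := by field_simp; ring
  rw [hinv, Real.inv_rpow (by positivity), inv_mul_le_iff₀ (by positivity), mul_one] at h
  refine le_trans (le_of_eq ?_) h
  field_simp
  ring

/-- Appending a point `x` admissible for the Yang-type inequality to `n` points with mean `G` and
mean square `T` multiplies `(1 + p) * G ^ 2 - T` by at most `((n + 1) / n) ^ (2 * p)`. -/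
theorem yang_step {p n G T x : ℝ} (hp : 0 < p) (hn : 1 ≤ n)
    (hx : x ^ 2 - 2 * (1 + p) * G * x + (1 + 2 * p) * T ≤ 0) :
    (1 + p) * ((n * G + x) / (n + 1)) ^ 2 - (n * T + x ^ 2) / (n + 1) ≤
      ((n + 1) / n) ^ (2 * p) * ((1 + p) * G ^ 2 - T) := by
  have hn1 : 0 < n + 1 := by linarith
  set F := (1 + p) * G ^ 2 - T with hF
  set y := x - (1 + p) * G with hy
  set δ := 2 * (p * (1 + p)) / (3 * (n + 1)) with hδ
  have hδ0 : 0 < δ := by positivity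
  have hH : y ^ 2 + p * (1 + p) * G ^ 2 ≤ (1 + 2 * p) * F := by
    rw [hF, hy]; linarith
  have hF0 : 0 ≤ F := by
    refine nonneg_of_mul_nonneg_right (a := 1 + 2 * p) (le_trans ?_ hH) (by linarith)
    positivity
  refine le_trans ?_ (mul_le_mul_of_nonneg_right (taylor_le_div_rpow hp hn) hF0)
  have hsq : 0 ≤ (2 * n + 1 + δ) * y ^ 2 - 2 * (p * (1 + p)) * y * G
      + p * (1 + p) * δ * G ^ 2 := by
    have hs : 0 ≤ 3 * (n + 1) / 2 * (y - δ * G) ^ 2 := by positivity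
    have hq : p * (1 + p) = 3 * (n + 1) / 2 * δ := by rw [hδ]; field_simp
    have hr : 0 ≤ ((n - 1) / 2 + δ) * y ^ 2 :=
      mul_nonneg (by linarith) (sq_nonneg y)
    rw [hq]
    linarith
  have hm := mul_le_mul_of_nonneg_left hH (by linarith : 0 ≤ n + 1 + p + δ)
  have hdiff : (1 + 2 * p / (n + 1) + p * (2 * p + 1) / (n + 1) ^ 2
      + 2 * p * (2 * p + 1) * (p + 1) / (3 * (n + 1) ^ 3)) * F
      - ((1 + p) * ((n * G + x) / (n + 1)) ^ 2 - (n * T + x ^ 2) / (n + 1))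
      = ((n + 1 + p + δ) * ((1 + 2 * p) * F)
        - (n * (p * (1 + p)) * G ^ 2 - n * y ^ 2 + p * ((1 + p) * G + y) ^ 2)) / (n + 1) ^ 2 := by
    rw [hδ, hF, hy]
    field_simp
    ring
  rw [← sub_nonneg, hdiff]
  refine div_nonneg ?_ (by positivity)
  linarith

/-- For a nondecreasing sequence of positive reals satisfying the Yang-type
inequality with parameter `t > 0`, one has `F k ≤ (2/t) k^(4/t) μ₁²` for all
`k ≥ 1`. The sequence is `1`-indexed: `μ i` for `i ≥ 1` denotes `μ_i`. -/
theorem cheng_yang_F_bound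
    (t : ℝ) (ht : 0 < t) (μ : ℕ → ℝ)
    (hpos : ∀ i, 1 ≤ i → 0 < μ i)
    (hmono : ∀ i j, 1 ≤ i → i ≤ j → μ i ≤ μ j)
    (hyang : ∀ k, 1 ≤ k →
      ∑ i ∈ Finset.Icc 1 k, (μ (k + 1) - μ i) ^ 2 ≤
        (4 / t) * ∑ i ∈ Finset.Icc 1 k, μ i * (μ (k + 1) - μ i))
    (G T F : ℕ → ℝ)
    (hG : ∀ k, G k = (1 / (k : ℝ)) * ∑ i ∈ Finset.Icc 1 k, μ i)
    (hT : ∀ k, T k = (1 / (k : ℝ)) * ∑ i ∈ Finset.Icc 1 k, (μ i) ^ 2)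
    (hF : ∀ k, F k = (1 + 2 / t) * (G k) ^ 2 - T k) :
    ∀ k, 1 ≤ k → F k ≤ (2 / t) * (k : ℝ) ^ ((4 : ℝ) / t) * (μ 1) ^ 2 := by
  have hstep : ∀ k : ℕ, 1 ≤ k →
      F (k + 1) ≤ (((k : ℝ) + 1) / k) ^ ((4 : ℝ) / t) * F k := by
    intro k hk
    have hk1 : (1 : ℝ) ≤ k := by exact_mod_cast hk
    have hk0 : (0 : ℝ) < k := by linarith
    have hSG : ∑ i ∈ Finset.Icc 1 k, μ i = k * G k := by rw [hG]; field_simp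
    have hST : ∑ i ∈ Finset.Icc 1 k, μ i ^ 2 = k * T k := by rw [hT]; field_simp
    have hx : μ (k + 1) ^ 2 - 2 * (1 + 2 / t) * G k * μ (k + 1)
        + (1 + 2 * (2 / t)) * T k ≤ 0 := by
      have h := hyang k hk
      have h₁ : ∑ i ∈ Finset.Icc 1 k, (μ (k + 1) - μ i) ^ 2
          = k * (μ (k + 1) ^ 2 - 2 * μ (k + 1) * G k + T k) := by
        simp only [sub_sq, Finset.sum_add_distrib, Finset.sum_sub_distrib, ← Finset.mul_sum,
          hSG, hST, Finset.sum_const, Nat.card_Icc, nsmul_eq_mul, Nat.add_sub_cancel]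
        ring
      have h₂ : ∑ i ∈ Finset.Icc 1 k, μ i * (μ (k + 1) - μ i)
          = k * (μ (k + 1) * G k - T k) := by
        simp only [mul_sub, ← sq, Finset.sum_sub_distrib, ← Finset.sum_mul, hSG, hST]
        ring
      rw [h₁, h₂, mul_left_comm] at h
      have h' := le_of_mul_le_mul_left h hk0
      have h4 : 4 / t = 2 * (2 / t) := by ring
      rw [h4] at h'
      linarith
    have hG' : G (k + 1) = (k * G k + μ (k + 1)) / (k + 1) := by
      rw [hG (k + 1), Finset.sum_Icc_succ_top (by lia), hSG]
      push_cast
      ring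
    have hT' : T (k + 1) = (k * T k + μ (k + 1) ^ 2) / (k + 1) := by
      rw [hT (k + 1), Finset.sum_Icc_succ_top (by lia), hST]
      push_cast
      ring
    have h := yang_step (by positivity : 0 < 2 / t) hk1 hx
    rw [hF, hF, hG', hT']
    rwa [show 2 * (2 / t) = 4 / t by ring] at h
  intro k hk
  induction k, hk using Nat.le_induction with
  | base =>
    rw [hF, hG, hT]
    simp only [Finset.Icc_self, Finset.sum_singleton, Nat.cast_one, Real.one_rpow]
    linarith
  | succ k hk ih =>
    have hk0 : (0 : ℝ) < k := by exact_mod_cast hk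
    calc F (k + 1) ≤ (((k : ℝ) + 1) / k) ^ ((4 : ℝ) / t) * F k := hstep k hk
      _ ≤ (((k : ℝ) + 1) / k) ^ ((4 : ℝ) / t)
          * ((2 / t) * (k : ℝ) ^ ((4 : ℝ) / t) * (μ 1) ^ 2) := by gcongr
      _ = (2 / t) * ((k + 1 : ℕ) : ℝ) ^ ((4 : ℝ) / t) * (μ 1) ^ 2 := by
        rw [Real.div_rpow (by positivity) hk0.le]
        push_cast
        field_simp
end

section
/- Let n > 0, ρ > 0 and C ≥ 0 be real numbers and (μ_k)_{k≥1} a nondecreasing sequence of positive real numbers tending to infinity such that R_ρ(z) ≤ C z^{ρ + n/2} for every z ≥ 0. Then for every t > 0 the heat trace satisfies ∑_{k≥1} e^{−μ_k t} ≤ C (Γ(ρ + 1 + n/2) / Γ(ρ + 1)) t^{−n/2}. -/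
/-- The Riesz mean of order `ρ` of a sequence `μ`:
`R_ρ(z) = ∑_{k≥1} (z − μ_k)₊^ρ`. The sequence is `0`-indexed, i.e. `μ k`
denotes `μ_{k+1}`. -/
noncomputable def rieszMean (μ : ℕ → ℝ) (ρ z : ℝ) : ℝ :=
  ∑' k : ℕ, (max (z - μ k) 0) ^ ρ

open MeasureTheory in
/-- The integral over the line of `x₊ ^ a * exp (-(t * x))` is a Gamma integral. -/
theorem integral_max_rpow_mul_exp_neg_mul {a t : ℝ} (ha : 0 < a) (ht : 0 < t) :
    ∫ x : ℝ, (max x 0) ^ a * Real.exp (-(t * x)) =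
      (1 / t) ^ (a + 1) * Real.Gamma (a + 1) := by
  rw [← Real.integral_rpow_mul_exp_neg_mul_Ioi (by linarith : 0 < a + 1) ht,
    ← setIntegral_eq_integral_of_forall_compl_eq_zero (s := Set.Ioi 0)]
  · refine setIntegral_congr_fun measurableSet_Ioi fun x hx => ?_
    simp [max_eq_left (Set.mem_Ioi.mp hx).le]
  · intro x hx
    rw [max_eq_right (not_lt.mp hx), Real.zero_rpow ha.ne', zero_mul]

open MeasureTheory in
theorem integrable_max_rpow_mul_exp_neg_mul {a t : ℝ} (ha : 0 < a) (ht : 0 < t) :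
    Integrable fun x : ℝ => (max x 0) ^ a * Real.exp (-(t * x)) := by
  refine not_imp_comm.mp integral_undef ?_
  rw [integral_max_rpow_mul_exp_neg_mul ha ht]
  have := Real.Gamma_pos_of_pos (by linarith : 0 < a + 1)
  positivity

theorem max_sub_rpow_mul_exp_neg_mul (a t m x : ℝ) :
    (max (x - m) 0) ^ a * Real.exp (-(t * x)) =
      Real.exp (-(m * t)) * ((max (x - m) 0) ^ a * Real.exp (-(t * (x - m)))) := by
  rw [show -(t * x) = -(m * t) + -(t * (x - m)) by ring, Real.exp_add]
  ring

open MeasureTheory in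
theorem integral_max_sub_rpow_mul_exp_neg_mul {a t : ℝ} (ha : 0 < a) (ht : 0 < t) (m : ℝ) :
    ∫ x : ℝ, (max (x - m) 0) ^ a * Real.exp (-(t * x)) =
      Real.exp (-(m * t)) * ((1 / t) ^ (a + 1) * Real.Gamma (a + 1)) := by
  simp_rw [max_sub_rpow_mul_exp_neg_mul a t m]
  rw [integral_const_mul,
    integral_sub_right_eq_self (fun x : ℝ => (max x 0) ^ a * Real.exp (-(t * x))) m,
    integral_max_rpow_mul_exp_neg_mul ha ht]

open MeasureTheory in
theorem integrable_max_sub_rpow_mul_exp_neg_mul {a t : ℝ} (ha : 0 < a) (ht : 0 < t) (m : ℝ) :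
    Integrable fun x : ℝ => (max (x - m) 0) ^ a * Real.exp (-(t * x)) := by
  simp_rw [max_sub_rpow_mul_exp_neg_mul a t m]
  exact ((integrable_max_rpow_mul_exp_neg_mul ha ht).comp_sub_right m).const_mul _

/-- For a sequence tending to infinity the series defining the Riesz mean is a finite sum. -/
theorem summable_rieszMean {μ : ℕ → ℝ} (htend : Filter.Tendsto μ Filter.atTop Filter.atTop)
    {ρ : ℝ} (hρ : 0 < ρ) (z : ℝ) : Summable fun k => (max (z - μ k) 0) ^ ρ := by
  obtain ⟨N, hN⟩ := Filter.eventually_atTop.mp (htend.eventually_ge_atTop z)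
  refine summable_of_ne_finset_zero (s := Finset.range N) fun k hk => ?_
  rw [max_eq_right (sub_nonpos.mpr (hN k (by simpa using hk))), Real.zero_rpow hρ.ne']

/-- If `R_ρ(z) ≤ C z^{ρ + n/2}` for all `z ≥ 0`, then the heat trace satisfies
`∑ e^{−μ_k t} ≤ C (Γ(ρ + 1 + n/2)/Γ(ρ + 1)) t^{−n/2}` for every `t > 0`. -/
theorem riesz_bound_implies_heat_trace_bound
    (n ρ C : ℝ) (hn : 0 < n) (hρ : 0 < ρ) (hC : 0 ≤ C) (μ : ℕ → ℝ)
    (hpos : ∀ k, 0 < μ k) (hmono : Monotone μ)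
    (htend : Filter.Tendsto μ Filter.atTop Filter.atTop)
    (hR : ∀ z : ℝ, 0 ≤ z → rieszMean μ ρ z ≤ C * z ^ (ρ + n / 2)) :
    ∀ t : ℝ, 0 < t →
      (∑' k : ℕ, Real.exp (-(μ k * t))) ≤
        C * (Real.Gamma (ρ + 1 + n / 2) / Real.Gamma (ρ + 1)) * t ^ (-(n / 2)) := by
  intro t ht
  have hΓ := Real.Gamma_pos_of_pos (by linarith : 0 < ρ + 1)
  have hρn : 0 < ρ + n / 2 := by positivity
  refine Real.tsum_le_of_sum_range_le (fun k => (Real.exp_pos _).le) fun N => ?_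
  have hpointwise : ∀ z : ℝ,
      ∑ k ∈ Finset.range N, (max (z - μ k) 0) ^ ρ * Real.exp (-(t * z)) ≤
        C * ((max z 0) ^ (ρ + n / 2) * Real.exp (-(t * z))) := by
    intro z
    rw [← Finset.sum_mul, ← mul_assoc]
    refine mul_le_mul_of_nonneg_right ?_ (Real.exp_pos _).le
    rcases le_total 0 z with hz | hz
    · rw [max_eq_left hz]
      exact ((summable_rieszMean htend hρ z).sum_le_tsum _ fun k _ => by positivity).trans (hR z hz)
    · rw [max_eq_right hz, Real.zero_rpow hρn.ne', mul_zero]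
      refine (Finset.sum_eq_zero fun k _ => ?_).le
      rw [max_eq_right (by linarith [hpos k]), Real.zero_rpow hρ.ne']
  have hintegral := MeasureTheory.integral_mono
    (MeasureTheory.integrable_finsetSum (Finset.range N) fun k _ =>
      integrable_max_sub_rpow_mul_exp_neg_mul hρ ht (μ k))
    ((integrable_max_rpow_mul_exp_neg_mul hρn ht).const_mul C) hpointwise
  rw [MeasureTheory.integral_finsetSum _ fun k _ =>
      integrable_max_sub_rpow_mul_exp_neg_mul hρ ht (μ k),
    MeasureTheory.integral_const_mul, integral_max_rpow_mul_exp_neg_mul hρn ht] at hintegral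
  simp_rw [integral_max_sub_rpow_mul_exp_neg_mul hρ ht] at hintegral
  have hpow : (1 / t) ^ (ρ + n / 2 + 1) = (1 / t) ^ (ρ + 1) * t ^ (-(n / 2)) := by
    rw [show ρ + n / 2 + 1 = (ρ + 1) + n / 2 by ring, Real.rpow_add (by positivity),
      Real.rpow_neg ht.le, one_div, Real.inv_rpow ht.le (n / 2)]
  rw [← Finset.sum_mul, hpow, show ρ + n / 2 + 1 = ρ + 1 + n / 2 by ring] at hintegral
  have hscale : 0 < (1 / t) ^ (ρ + 1) * Real.Gamma (ρ + 1) := by positivity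
  refine le_of_mul_le_mul_right (hintegral.trans_eq ?_) hscale
  field_simp
end

section
/- Abstract Cheng–Yang lower bound: Let n > 0 and A > 0 be real numbers and let μ_1 ≤ μ_2 ≤ ⋯ be a nondecreasing sequence of positive real numbers satisfying the Yang-type inequality with parameter n and such that μ_k / k^{2/n} → A as k → ∞. Then for every integer k ≥ 1, (1/k) ∑_{i=1}^k μ_i ≥ (n / √((n+2)(n+4))) · A · k^{2/n}. -/
open Filter Topology Asymptotics

/-- A convexity property of `sinh` on the half line. -/
lemma mul_sinh_le_sinh_mul {p y : ℝ} (hp : 1 ≤ p) (hy : 0 ≤ y) :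
    p * Real.sinh y ≤ Real.sinh (p * y) := by
  have hderiv (x : ℝ) : HasDerivAt (fun z => Real.sinh (p * z) - p * Real.sinh z)
      (Real.cosh (p * x) * p - p * Real.cosh x) x := by
    have hlin : HasDerivAt (fun z : ℝ => p * z) p x := by
      simpa using (hasDerivAt_id x).const_mul p
    exact hlin.sinh.sub ((Real.hasDerivAt_sinh x).const_mul p)
  have hmono : MonotoneOn (fun z => Real.sinh (p * z) - p * Real.sinh z) (Set.Ici 0) := by
    apply monotoneOn_of_hasDerivWithinAt_nonneg (convex_Ici 0)
      (fun x _ => (hderiv x).continuousAt.continuousWithinAt)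
      (fun x _ => (hderiv x).hasDerivWithinAt)
    intro x hx
    rw [interior_Ici, Set.mem_Ioi] at hx
    have hcosh : Real.cosh x ≤ Real.cosh (p * x) := by
      rw [Real.cosh_le_cosh, abs_of_pos hx, abs_of_pos (by positivity)]
      nlinarith
    nlinarith
  have := hmono (Set.mem_Ici.2 le_rfl) (Set.mem_Ici.2 hy) hy
  simp at this
  linarith

/-- A sharpening of Bernoulli's inequality for the powers of `(k + 1) / k`. -/
lemma sq_mul_rpow_le_mul_sq_rpow_sub_one {p k : ℝ} (hp : 1 ≤ p) (hk : 0 < k) :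
    p ^ 2 * ((k + 1) / k) ^ p ≤ k * (k + 1) * (((k + 1) / k) ^ p - 1) ^ 2 := by
  set y := Real.log ((k + 1) / k) / 2 with hy
  have hb : 0 < (k + 1) / k := by positivity
  have hy0 : 0 ≤ y := by
    have : 1 ≤ (k + 1) / k := by rw [le_div_iff₀ hk]; linarith
    have := Real.log_nonneg this
    positivity
  have hbase : Real.exp y ^ 2 = (k + 1) / k := by
    rw [← Real.exp_nat_mul, hy, ← Real.exp_log hb]
    congr 1
    simp only [Real.log_exp]
    push_cast
    ring
  have hpow : ((k + 1) / k) ^ p = Real.exp (p * y) ^ 2 := by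
    rw [Real.rpow_def_of_pos hb, ← Real.exp_nat_mul, hy]
    congr 1
    push_cast
    ring
  have hs := mul_sinh_le_sinh_mul hp hy0
  have hs0 : 0 ≤ p * Real.sinh y := by
    have := Real.sinh_nonneg_iff.2 hy0
    positivity
  have hsq := pow_le_pow_left₀ hs0 hs 2
  have hsinh (z : ℝ) : 4 * Real.exp z ^ 2 * Real.sinh z ^ 2 = (Real.exp z ^ 2 - 1) ^ 2 := by
    rw [Real.sinh_eq, Real.exp_neg]
    field_simp
    ring
  have h₁ := hsinh y
  rw [hbase] at h₁
  have h₂ : 4 * (k * (k + 1)) * Real.sinh y ^ 2 = 1 := by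
    field_simp at h₁
    nlinarith
  rw [hpow, ← hsinh]
  have h₃ : 0 ≤ 4 * (k * (k + 1)) * Real.exp (p * y) ^ 2 := by positivity
  calc p ^ 2 * Real.exp (p * y) ^ 2
      = 4 * (k * (k + 1)) * Real.exp (p * y) ^ 2 * (p * Real.sinh y) ^ 2 := by
        linear_combination (-(p ^ 2 * Real.exp (p * y) ^ 2)) * h₂
    _ ≤ 4 * (k * (k + 1)) * Real.exp (p * y) ^ 2 * Real.sinh (p * y) ^ 2 := by gcongr
    _ = _ := by ring

/-- A binary quadratic form with positive corner coefficient and nonnegative determinant is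
nonnegative. -/
lemma quadratic_form_nonneg {α β γ : ℝ} (hγ : 0 < γ) (hdet : β ^ 2 ≤ α * γ) (x y : ℝ) :
    0 ≤ α * x ^ 2 + 2 * β * x * y + γ * y ^ 2 := by
  have : 0 ≤ γ * (α * x ^ 2 + 2 * β * x * y + γ * y ^ 2) := by
    nlinarith [sq_nonneg (γ * y + β * x), mul_nonneg (sub_nonneg.2 hdet) (sq_nonneg x)]
  exact nonneg_of_mul_nonneg_right this hγ

/-- The algebraic core of the Cheng–Yang recursion: `L` and `T` are the means of the first `k`
terms and of their squares, `a` is the next term, and `c = 1 + 2 / n`. -/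
lemma cheng_yang_step {c k q L T a : ℝ} (hc : 1 < c) (hk : 0 < k) (hq : 1 < q)
    (hqk : (2 * c - 1) ^ 2 * q ≤ k * (k + 1) * (q - 1) ^ 2)
    (hyang : a ^ 2 - 2 * c * a * L + (2 * c - 1) * T ≤ 0) :
    c * (k * L + a) ^ 2 - (k + 1) * (k * T + a ^ 2) ≤
      k * (k + 1) * q * (c * L ^ 2 - T) := by
  have hp : 0 < 2 * c - 1 := by linarith
  obtain ⟨l, hl⟩ : ∃ l, l * (2 * c - 1) = k * (k + 1) * (q - 1) :=
    ⟨k * (k + 1) * (q - 1) / (2 * c - 1), by field_simp⟩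
  have hl0 : 0 < l := by
    have : 0 < k * (k + 1) * (q - 1) := by
      have := sub_pos.2 hq
      positivity
    rw [← hl] at this
    exact pos_of_mul_pos_left this hp.le
  have hchar : k * (k + 1) ≤ l ^ 2 - (2 * c - 1) * l := by
    have h₁ : (2 * c - 1) ^ 2 * (k * (k + 1) * q) ≤ (2 * c - 1) ^ 2 * l ^ 2 := by
      have := mul_le_mul_of_nonneg_left hqk (by positivity : 0 ≤ k * (k + 1))
      have e : (2 * c - 1) ^ 2 * l ^ 2 = (k * (k + 1) * (q - 1)) ^ 2 := by rw [← hl]; ring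
      rw [e]
      linarith
    have h₂ := le_of_mul_le_mul_left h₁ (by positivity)
    linarith
  have hlp : 2 * c - 1 < l := by
    have : 0 < l * (l - (2 * c - 1)) := by nlinarith [mul_pos hk (by linarith : 0 < k + 1)]
    linarith [pos_of_mul_pos_right this hl0.le]
  have hform := quadratic_form_nonneg (α := c * (c - 1) * (l - (k + c))) (β := -(c * (c - 1)))
    (γ := l - (c - 1 - k)) (by linarith)
    (by
      have hs : 0 ≤ c * (c - 1) := mul_nonneg (by linarith) (by linarith)
      have := mul_nonneg hs (sub_nonneg.2 hchar)
      linarith) L (a - c * L)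
  have hmul := mul_le_mul_of_nonneg_left hyang hl0.le
  linear_combination hform + hmul + (c * L ^ 2 - T) * hl

/-- The increments of `x ^ (s + 1)` along the integers are asymptotic to `(s + 1) x ^ s`. -/
lemma tendsto_rpow_increment_div (s : ℝ) :
    Tendsto (fun i : ℕ => (((i : ℝ) + 1) ^ (s + 1) - (i : ℝ) ^ (s + 1)) / ((i : ℝ) + 1) ^ s)
      atTop (𝓝 (s + 1)) := by
  have hd : HasDerivAt (fun x : ℝ => x ^ (s + 1)) (s + 1) 1 := by
    simpa using Real.hasDerivAt_rpow_const (x := 1) (p := s + 1) (Or.inl one_ne_zero)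
  have hh : Tendsto (fun i : ℕ => -(1 / ((i : ℝ) + 1))) atTop (𝓝[≠] 0) := by
    apply tendsto_nhdsWithin_iff.2
    refine ⟨by simpa using (tendsto_one_div_add_atTop_nhds_zero_nat (𝕜 := ℝ)).neg, ?_⟩
    exact Eventually.of_forall fun i => by
      simp only [Set.mem_compl_iff, Set.mem_singleton_iff]
      exact neg_ne_zero.2 (by positivity)
  refine ((hasDerivAt_iff_tendsto_slope_zero.1 hd).comp hh).congr fun i => ?_
  have hi : 0 < (i : ℝ) + 1 := by positivity
  have he : 1 + -(1 / ((i : ℝ) + 1)) = i / (i + 1) := by field_simp; ring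
  simp only [Function.comp_apply, he, Real.one_rpow, smul_eq_mul]
  rw [Real.div_rpow (by positivity) hi.le, Real.rpow_add_one hi.ne']
  field_simp
  ring

/-- A Cesàro-type statement: sums of a sequence asymptotic to `B k ^ s`. -/
lemma tendsto_sum_Icc_div_rpow {u : ℕ → ℝ} {s B : ℝ} (hs : 0 < s)
    (hu : Tendsto (fun k : ℕ => u k / (k : ℝ) ^ s) atTop (𝓝 B)) :
    Tendsto (fun k : ℕ => (∑ i ∈ Finset.Icc 1 k, u i) / (k : ℝ) ^ (s + 1)) atTop
      (𝓝 (B / (s + 1))) := by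
  set v : ℕ → ℝ := fun i => ((i : ℝ) + 1) ^ (s + 1) - (i : ℝ) ^ (s + 1) with hv
  have hvpos (i : ℕ) : 0 < v i :=
    sub_pos.2 (Real.rpow_lt_rpow (by positivity) (by linarith) (by linarith))
  have hvsum (k : ℕ) : ∑ i ∈ Finset.range k, v i = (k : ℝ) ^ (s + 1) := by
    have := Finset.sum_range_sub (fun i : ℕ => (i : ℝ) ^ (s + 1)) k
    simpa [hv, Real.zero_rpow (by linarith : s + 1 ≠ 0)] using this
  have husum (k : ℕ) : ∑ i ∈ Finset.Icc 1 k, u i = ∑ i ∈ Finset.range k, u (i + 1) := by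
    induction k with
    | zero => simp
    | succ k ih => rw [Finset.sum_Icc_succ_top (by omega), Finset.sum_range_succ, ih]
  have hratio : Tendsto (fun i => u (i + 1) / v i) atTop (𝓝 (B / (s + 1))) := by
    refine ((hu.comp (tendsto_add_atTop_nat 1)).div (tendsto_rpow_increment_div s)
      (by linarith)).congr fun i => ?_
    have : 0 < ((i : ℝ) + 1) ^ s := by positivity
    simp only [Function.comp_apply, Nat.cast_add, Nat.cast_one, Pi.div_apply]
    exact div_div_div_cancel_right₀ this.ne' _ _
  have hlittle : (fun i => u (i + 1) - B / (s + 1) * v i) =o[atTop] v := by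
    rw [isLittleO_iff_tendsto fun i hi => absurd hi (hvpos i).ne']
    have h := hratio.sub_const (B / (s + 1))
    rw [sub_self] at h
    refine h.congr fun i => ?_
    have := (hvpos i).ne'
    field_simp
  have htop : Tendsto (fun k : ℕ => (k : ℝ) ^ (s + 1)) atTop atTop :=
    (tendsto_rpow_atTop (by linarith)).comp tendsto_natCast_atTop_atTop
  have hsum := hlittle.sum_range (fun i => (hvpos i).le) (by simpa only [hvsum] using htop)
  simp only [Finset.sum_sub_distrib, ← Finset.mul_sum, hvsum, ← husum] at hsum
  have h := hsum.tendsto_div_nhds_zero.add_const (B / (s + 1))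
  rw [zero_add] at h
  refine h.congr' ?_
  filter_upwards [eventually_gt_atTop 0] with k hk
  have : 0 < (k : ℝ) ^ (s + 1) := by positivity
  field_simp
  ring

/-- Abstract Cheng–Yang lower bound: for a nondecreasing sequence of positive
reals satisfying the Yang-type inequality with parameter `n > 0` and with
`μ_k / k^{2/n} → A`, one has
`(1/k) ∑_{i=1}^k μ_i ≥ (n/√((n+2)(n+4))) A k^{2/n}` for all `k ≥ 1`.
The sequence is `1`-indexed: `μ i` for `i ≥ 1` denotes `μ_i`. -/
theorem abstract_cheng_yang_lower_bound
    (n A : ℝ) (hn : 0 < n) (hA : 0 < A) (μ : ℕ → ℝ)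
    (hpos : ∀ i, 1 ≤ i → 0 < μ i)
    (hmono : ∀ i j, 1 ≤ i → i ≤ j → μ i ≤ μ j)
    (hyang : ∀ k, 1 ≤ k →
      ∑ i ∈ Finset.Icc 1 k, (μ (k + 1) - μ i) ^ 2 ≤
        (4 / n) * ∑ i ∈ Finset.Icc 1 k, μ i * (μ (k + 1) - μ i))
    (hlim : Filter.Tendsto (fun k : ℕ => μ k / (k : ℝ) ^ ((2 : ℝ) / n))
      Filter.atTop (nhds A)) :
    ∀ k : ℕ, 1 ≤ k →
      (1 / (k : ℝ)) * ∑ i ∈ Finset.Icc 1 k, μ i ≥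
        n / Real.sqrt ((n + 2) * (n + 4)) * A * (k : ℝ) ^ ((2 : ℝ) / n) := by
  set c : ℝ := 1 + 2 / n with hc
  have hn2 : 0 < 2 / n := by positivity
  set L : ℕ → ℝ := fun k => (∑ i ∈ Finset.Icc 1 k, μ i) / k with hL
  set T : ℕ → ℝ := fun k => (∑ i ∈ Finset.Icc 1 k, μ i ^ 2) / k with hT
  set F : ℕ → ℝ := fun k => (c * L k ^ 2 - T k) / (k : ℝ) ^ (4 / n) with hF
  have hstep (k : ℕ) (hk : 1 ≤ k) : F (k + 1) ≤ F k := by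
    have hk0 : (0 : ℝ) < k := by exact_mod_cast hk
    have hSk : ∑ i ∈ Finset.Icc 1 k, μ i = k * L k := by simp only [hL]; field_simp
    have hQk : ∑ i ∈ Finset.Icc 1 k, μ i ^ 2 = k * T k := by simp only [hT]; field_simp
    have hLk : L (k + 1) = (k * L k + μ (k + 1)) / (k + 1) := by
      rw [← hSk, ← Finset.sum_Icc_succ_top (by omega)]
      simp [hL]
    have hTk : T (k + 1) = (k * T k + μ (k + 1) ^ 2) / (k + 1) := by
      rw [← hQk, ← Finset.sum_Icc_succ_top (f := fun i => μ i ^ 2) (by omega)]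
      simp [hT]
    have hyang' : μ (k + 1) ^ 2 - 2 * c * μ (k + 1) * L k + (2 * c - 1) * T k ≤ 0 := by
      have hy := hyang k hk
      have e₁ : ∑ i ∈ Finset.Icc 1 k, (μ (k + 1) - μ i) ^ 2 =
          k * μ (k + 1) ^ 2 - 2 * μ (k + 1) * (k * L k) + k * T k := by
        simp only [sub_sq, Finset.sum_add_distrib, Finset.sum_sub_distrib, ← Finset.mul_sum,
          hSk, hQk]
        simp
      have e₂ : ∑ i ∈ Finset.Icc 1 k, μ i * (μ (k + 1) - μ i) =
          k * L k * μ (k + 1) - k * T k := by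
        simp only [mul_sub, Finset.sum_sub_distrib, ← Finset.sum_mul, ← sq, hSk, hQk]
      rw [e₁, e₂] at hy
      refine nonpos_of_mul_nonpos_right (a := (k : ℝ)) ?_ hk0
      rw [hc]
      linear_combination hy
    have hb : 1 < ((k : ℝ) + 1) / k := by rw [lt_div_iff₀ hk0]; linarith
    have hp : 1 < 2 * c - 1 := by linarith
    have hmain := cheng_yang_step (q := (((k : ℝ) + 1) / k) ^ (2 * c - 1)) (by linarith) hk0
      (Real.one_lt_rpow hb (by linarith)) (sq_mul_rpow_le_mul_sq_rpow_sub_one hp.le hk0) hyang'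
    have hexp : 2 * c - 1 = 4 / n + 1 := by rw [hc]; ring
    rw [hexp, Real.rpow_add_one (by positivity), Real.div_rpow (by positivity) hk0.le] at hmain
    have hx : (0 : ℝ) < (k : ℝ) ^ (4 / n) := by positivity
    have hx' : (0 : ℝ) < ((k : ℝ) + 1) ^ (4 / n) := by positivity
    simp only [hF, hLk, hTk, Nat.cast_add, Nat.cast_one]
    rw [div_le_iff₀ hx']
    have hk1 : (0 : ℝ) < ((k : ℝ) + 1) ^ 2 := by positivity
    refine le_of_mul_le_mul_left ?_ hk1
    calc _ = c * (k * L k + μ (k + 1)) ^ 2 - (k + 1) * (k * T k + μ (k + 1) ^ 2) := by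
          field_simp
      _ ≤ _ := hmain
      _ = _ := by field_simp
  have hlimL : Tendsto (fun k : ℕ => L k / (k : ℝ) ^ (2 / n)) atTop (𝓝 (A / (2 / n + 1))) := by
    refine (tendsto_sum_Icc_div_rpow hn2 hlim).congr' ?_
    filter_upwards [eventually_gt_atTop 0] with k hk
    have hk0 : (0 : ℝ) < k := by exact_mod_cast hk
    rw [Real.rpow_add_one hk0.ne', div_div, mul_comm]
  have hsq (k : ℕ) : ((k : ℝ) ^ (2 / n)) ^ 2 = (k : ℝ) ^ (4 / n) := by
    rw [← Real.rpow_mul_natCast (by positivity)]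
    congr 1
    push_cast
    ring
  have hlimT : Tendsto (fun k : ℕ => T k / (k : ℝ) ^ (4 / n)) atTop
      (𝓝 (A ^ 2 / (4 / n + 1))) := by
    have hlim2 : Tendsto (fun k : ℕ => μ k ^ 2 / (k : ℝ) ^ (4 / n)) atTop (𝓝 (A ^ 2)) :=
      (hlim.pow 2).congr fun k => by rw [div_pow, hsq]
    refine (tendsto_sum_Icc_div_rpow (by positivity) hlim2).congr' ?_
    filter_upwards [eventually_gt_atTop 0] with k hk
    have hk0 : (0 : ℝ) < k := by exact_mod_cast hk
    rw [Real.rpow_add_one hk0.ne', div_div, mul_comm]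
  have hlimF : Tendsto F atTop (𝓝 (2 * n * A ^ 2 / ((n + 2) * (n + 4)))) := by
    have h := ((hlimL.pow 2).const_mul c).sub hlimT
    have e : c * (A / (2 / n + 1)) ^ 2 - A ^ 2 / (4 / n + 1) =
        2 * n * A ^ 2 / ((n + 2) * (n + 4)) := by
      rw [hc]
      field_simp
      ring
    rw [e] at h
    refine h.congr fun k => ?_
    simp only [hF]
    rw [div_pow, hsq]
    ring
  intro k hk
  have hk0 : (0 : ℝ) < k := by exact_mod_cast hk
  have hFk : 2 * n * A ^ 2 / ((n + 2) * (n + 4)) ≤ F k := by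
    refine le_of_tendsto hlimF ?_
    filter_upwards [eventually_ge_atTop k] with m hm
    induction m, hm using Nat.le_induction with
    | base => exact le_rfl
    | succ m hm ih => exact (hstep m (hk.trans hm)).trans ih
  have hLT : L k ^ 2 ≤ T k := by
    have := sq_sum_le_card_mul_sum_sq (s := Finset.Icc 1 k) (f := μ)
    simp only [Nat.card_Icc, add_tsub_cancel_right] at this
    simp only [hL, hT]
    rw [div_pow, div_le_div_iff₀ (by positivity) hk0]
    nlinarith
  have hLpos : 0 ≤ L k :=
    div_nonneg (Finset.sum_nonneg fun i hi => (hpos i (Finset.mem_Icc.1 hi).1).le) hk0.le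
  have hbound : 2 * n * A ^ 2 / ((n + 2) * (n + 4)) * (k : ℝ) ^ (4 / n) ≤ 2 / n * L k ^ 2 := by
    have h := (le_div_iff₀ (by positivity)).1 hFk
    rw [hc] at h
    linarith
  have hgoal : n / Real.sqrt ((n + 2) * (n + 4)) * A * (k : ℝ) ^ (2 / n) ≤ L k := by
    refine (pow_le_pow_iff_left₀ (by positivity) hLpos two_ne_zero).1 ?_
    rw [mul_pow, mul_pow, div_pow, Real.sq_sqrt (by positivity), hsq]
    refine le_of_mul_le_mul_left ?_ hn2
    refine le_trans (le_of_eq ?_) hbound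
    field_simp
  rw [ge_iff_le, one_div_mul_eq_div]
  exact hgoal
end
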